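/- arXiv:2010.02324 — 3 statements merged into one kernel-verified Lean document; each statement's English description precedes it below -/
import Mathlib

section
/- Let G be a finite simple graph, M a matching in G, and P an M-augmenting path in G. Then the symmetric difference M ⊕ E(P) is a matching in G, and |M ⊕ E(P)| = |M| + 1. Moreover every vertex matched by M is still matched by M ⊕ E(P), and both endpoints of P are matched by M ⊕ E(P). -/
open scoped symmDiff

variable {V : Type*}

/-- `M` is a matching in the simple graph `G`: a set of edges of `G`,
no two of which share a vertex. -/
def IsMatchingOn (G : SimpleGraph V) (M : Finset (Sym2 V)) : Prop :=
  ↑M ⊆ G.edgeSet ∧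
    ∀ e ∈ M, ∀ f ∈ M, e ≠ f → ∀ v : V, v ∈ e → v ∉ f

/-- A vertex is free (with respect to the edge set `M`) if it lies on no edge of `M`. -/
def IsFreeVertex (M : Finset (Sym2 V)) (v : V) : Prop :=
  ∀ e ∈ M, v ∉ e

/-- The edges of the walk `p` alternate between edges not in `M` and edges in `M`,
starting (and, when the final vertex is free, ending) with an edge not in `M`:
the `i`-th edge lies in `M` exactly when `i` is odd. -/
def IsAlternatingWalk (M : Finset (Sym2 V)) {G : SimpleGraph V} {u v : V}
    (p : G.Walk u v) : Prop :=
  ∀ (i : ℕ) (h : i < p.edges.length), (p.edges.get ⟨i, h⟩ ∈ M ↔ i % 2 = 1)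

/-- An `M`-augmenting path in `G`: a path between two distinct free vertices whose
edges alternate between edges not in `M` and edges in `M`, starting and ending
with edges not in `M`. -/
def IsAugmentingPath (G : SimpleGraph V) (M : Finset (Sym2 V)) {u v : V}
    (p : G.Walk u v) : Prop :=
  p.IsPath ∧ u ≠ v ∧ IsFreeVertex M u ∧ IsFreeVertex M v ∧ IsAlternatingWalk M p

theorem SimpleGraph.Walk.mem_edges_iff_exists_getVert {G : SimpleGraph V} {u v : V}
    (p : G.Walk u v) (e : Sym2 V) :
    e ∈ p.edges ↔ ∃ i < p.length, s(p.getVert i, p.getVert (i + 1)) = e := by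
  simp [List.mem_iff_getElem, SimpleGraph.Walk.getElem_edges]

theorem SimpleGraph.Walk.IsPath.getVert_mem_edge_iff {G : SimpleGraph V} {u v : V}
    {p : G.Walk u v} (hp : p.IsPath) {i j : ℕ} (hi : i < p.length) (hj : j ≤ p.length) :
    p.getVert j ∈ s(p.getVert i, p.getVert (i + 1)) ↔ j = i ∨ j = i + 1 := by
  rw [Sym2.mem_iff, hp.getVert_injOn.eq_iff (by simpa using hj) (by simpa using hi.le),
    hp.getVert_injOn.eq_iff (by simpa using hj) (by simpa using hi)]

theorem SimpleGraph.Walk.IsPath.edge_injOn {G : SimpleGraph V} {u v : V}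
    {p : G.Walk u v} (hp : p.IsPath) :
    Set.InjOn (fun i => s(p.getVert i, p.getVert (i + 1))) {i | i < p.length} := by
  intro i hi j hj h
  simp only [Set.mem_ofPred_eq] at hi hj h
  have h₁ := (hp.getVert_mem_edge_iff hj hi.le).1 (h ▸ Sym2.mem_mk_left _ _)
  have h₂ := (hp.getVert_mem_edge_iff hj hi).1 (h ▸ Sym2.mem_mk_right _ _)
  lia

theorem IsAlternatingWalk.edge_mem_iff {G : SimpleGraph V} {M : Finset (Sym2 V)} {u v : V}
    {p : G.Walk u v} (h : IsAlternatingWalk M p) {i : ℕ} (hi : i < p.length) :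
    s(p.getVert i, p.getVert (i + 1)) ∈ M ↔ i % 2 = 1 := by
  rw [← h i (by simpa using hi), List.get_eq_getElem,
    SimpleGraph.Walk.getElem_edges]

namespace IsAugmentingPath

variable {G : SimpleGraph V} {M : Finset (Sym2 V)} {u v : V} {p : G.Walk u v}

theorem length_odd (hp : IsAugmentingPath G M p) : p.length % 2 = 1 := by
  obtain ⟨-, huv, -, hv, halt⟩ := hp
  have hpos : 0 < p.length := by
    by_contra h
    exact huv (p.eq_of_length_eq_zero (by lia))
  by_contra h
  have hlast := (halt.edge_mem_iff (i := p.length - 1) (by lia)).2 (by lia)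
  rw [Nat.sub_add_cancel hpos, p.getVert_length] at hlast
  exact hv _ hlast (Sym2.mem_mk_right _ _)

/-- Every matching edge meeting an augmenting path is an edge of the path. -/
theorem mem_edges_of_mem_support (hp : IsAugmentingPath G M p) (hM : IsMatchingOn G M)
    {e : Sym2 V} (he : e ∈ M) {w : V} (hw : w ∈ e) (hwp : w ∈ p.support) : e ∈ p.edges := by
  obtain ⟨j, rfl, hj⟩ := SimpleGraph.Walk.mem_support_iff_exists_getVert.1 hwp
  have hodd := hp.length_odd
  obtain ⟨hpath, -, hu, hv, halt⟩ := hp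
  have hj0 : j ≠ 0 := by
    rintro rfl
    exact hu e he (by simpa using hw)
  have hjl : j ≠ p.length := by
    rintro rfl
    exact hv e he (by simpa using hw)
  obtain ⟨k, hk, hkj⟩ : ∃ k, k % 2 = 1 ∧ (j = k ∨ j = k + 1) := by
    rcases Nat.mod_two_eq_zero_or_one j with h | h
    · exact ⟨j - 1, by lia, by lia⟩
    · exact ⟨j, h, Or.inl rfl⟩
  have hkl : k < p.length := by lia
  rw [p.mem_edges_iff_exists_getVert]
  refine ⟨k, hkl, ?_⟩
  by_contra hne
  exact hM.2 _ ((halt.edge_mem_iff hkl).2 hk) e he hne _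
    ((hpath.getVert_mem_edge_iff hkl hj).2 hkj) hw

theorem mem_symmDiff_iff [DecidableEq V] (hp : IsAugmentingPath G M p) {e : Sym2 V} :
    e ∈ M ∆ p.edges.toFinset ↔ (e ∈ M ∧ e ∉ p.edges) ∨
      ∃ i < p.length, i % 2 = 0 ∧ s(p.getVert i, p.getVert (i + 1)) = e := by
  rw [Finset.mem_symmDiff, List.mem_toFinset]
  refine or_congr_right ⟨?_, ?_⟩
  · rintro ⟨he, heM⟩
    obtain ⟨i, hi, rfl⟩ := (p.mem_edges_iff_exists_getVert e).1 he
    rw [hp.2.2.2.2.edge_mem_iff hi] at heM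
    exact ⟨i, hi, by lia, rfl⟩
  · rintro ⟨i, hi, hi2, rfl⟩
    rw [hp.2.2.2.2.edge_mem_iff hi]
    exact ⟨(p.mem_edges_iff_exists_getVert _).2 ⟨i, hi, rfl⟩, by lia⟩

theorem not_isFreeVertex_symmDiff_of_mem_support [DecidableEq V] (hp : IsAugmentingPath G M p)
    {w : V} (hw : w ∈ p.support) : ¬ IsFreeVertex (M ∆ p.edges.toFinset) w := by
  obtain ⟨j, rfl, hj⟩ := SimpleGraph.Walk.mem_support_iff_exists_getVert.1 hw
  have hodd := hp.length_odd
  obtain ⟨k, hk, hkj⟩ : ∃ k, k % 2 = 0 ∧ (j = k ∨ j = k + 1) := by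
    rcases Nat.mod_two_eq_zero_or_one j with h | h
    · exact ⟨j, h, Or.inl rfl⟩
    · exact ⟨j - 1, by lia, by lia⟩
  have hkl : k < p.length := by lia
  exact fun hfree => hfree _ (hp.mem_symmDiff_iff.2 (Or.inr ⟨k, hkl, hk, rfl⟩))
    ((hp.1.getVert_mem_edge_iff hkl hj).2 hkj)

theorem isMatchingOn_symmDiff [DecidableEq V] (hp : IsAugmentingPath G M p)
    (hM : IsMatchingOn G M) : IsMatchingOn G (M ∆ p.edges.toFinset) := by
  refine ⟨fun e he => ?_, fun e he f hf hef w hwe hwf => ?_⟩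
  · rcases Finset.mem_symmDiff.1 he with ⟨h, -⟩ | ⟨h, -⟩
    · exact hM.1 h
    · exact p.edges_subset_edgeSet (List.mem_toFinset.1 h)
  · have mem_support {i : ℕ} (h : w ∈ s(p.getVert i, p.getVert (i + 1))) : w ∈ p.support := by
      rcases Sym2.mem_iff.1 h with rfl | rfl <;> exact p.getVert_mem_support _
    rcases hp.mem_symmDiff_iff.1 he with ⟨heM, hep⟩ | ⟨i, hi, hi2, rfl⟩ <;>
      rcases hp.mem_symmDiff_iff.1 hf with ⟨hfM, hfp⟩ | ⟨k, hk, hk2, rfl⟩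
    · exact hM.2 e heM f hfM hef w hwe hwf
    · exact hep (hp.mem_edges_of_mem_support hM heM hwe (mem_support hwf))
    · exact hfp (hp.mem_edges_of_mem_support hM hfM hwf (mem_support hwe))
    · obtain ⟨j, rfl, hj⟩ :=
        SimpleGraph.Walk.mem_support_iff_exists_getVert.1 (mem_support hwe)
      rw [hp.1.getVert_mem_edge_iff hi hj] at hwe
      rw [hp.1.getVert_mem_edge_iff hk hj] at hwf
      obtain rfl : i = k := by lia
      exact hef rfl

theorem card_symmDiff [DecidableEq V] (hp : IsAugmentingPath G M p) :
    (M ∆ p.edges.toFinset).card = M.card + 1 := by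
  obtain ⟨m, hm⟩ : ∃ m, p.length = 2 * m + 1 := ⟨p.length / 2, by have := hp.length_odd; lia⟩
  have halt := hp.2.2.2.2
  have hinter : (M ∩ p.edges.toFinset).card = m := by
    have : M ∩ p.edges.toFinset = (Finset.range m).image
        (fun i => s(p.getVert (2 * i + 1), p.getVert (2 * i + 1 + 1))) := by
      ext e
      simp only [Finset.mem_inter, List.mem_toFinset, Finset.mem_image, Finset.mem_range,
        p.mem_edges_iff_exists_getVert]
      constructor
      · rintro ⟨heM, i, hi, rfl⟩
        rw [halt.edge_mem_iff hi] at heM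
        obtain ⟨k, rfl⟩ : ∃ k, i = 2 * k + 1 := ⟨i / 2, by lia⟩
        exact ⟨k, by lia, rfl⟩
      · rintro ⟨k, hk, rfl⟩
        have hkl : 2 * k + 1 < p.length := by lia
        exact ⟨(halt.edge_mem_iff hkl).2 (by lia), _, hkl, rfl⟩
    rw [this, Finset.card_image_of_injOn, Finset.card_range]
    intro i hi k hk h
    rw [Finset.coe_range, Set.mem_Iio] at hi hk
    have := hp.1.edge_injOn (show 2 * i + 1 < p.length by lia)
      (show 2 * k + 1 < p.length by lia) h
    lia
  have hcard : p.edges.toFinset.card = p.length := by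
    rw [List.toFinset_card_of_nodup hp.1.isTrail.edges_nodup, p.length_edges]
  have h₁ := Finset.card_inter_add_card_sdiff M p.edges.toFinset
  have h₂ := Finset.card_inter_add_card_sdiff p.edges.toFinset M
  rw [Finset.inter_comm] at h₂
  rw [symmDiff, Finset.sup_eq_union, Finset.card_union_of_disjoint disjoint_sdiff_sdiff]
  lia

end IsAugmentingPath

/-- If `M` is a matching in the finite simple graph `G` and `p` is an
`M`-augmenting path, then the symmetric difference `M ∆ E(p)` is a matching in `G` of
cardinality `|M| + 1`; moreover every vertex matched by `M` is still matched by
`M ∆ E(p)`, and both endpoints of `p` are matched by `M ∆ E(p)`. -/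
theorem augment_along_augmenting_path [Fintype V] [DecidableEq V]
    (G : SimpleGraph V) (M : Finset (Sym2 V)) (hM : IsMatchingOn G M)
    {u v : V} (p : G.Walk u v) (hp : IsAugmentingPath G M p) :
    IsMatchingOn G (M ∆ p.edges.toFinset) ∧
      (M ∆ p.edges.toFinset).card = M.card + 1 ∧
      (∀ w : V, ¬ IsFreeVertex M w → ¬ IsFreeVertex (M ∆ p.edges.toFinset) w) ∧
      ¬ IsFreeVertex (M ∆ p.edges.toFinset) u ∧
      ¬ IsFreeVertex (M ∆ p.edges.toFinset) v := by
  refine ⟨hp.isMatchingOn_symmDiff hM, hp.card_symmDiff, fun w hw => ?_,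
    hp.not_isFreeVertex_symmDiff_of_mem_support p.start_mem_support,
    hp.not_isFreeVertex_symmDiff_of_mem_support p.end_mem_support⟩
  by_cases hwp : w ∈ p.support
  · exact hp.not_isFreeVertex_symmDiff_of_mem_support hwp
  · refine fun hfree => hw fun e he hwe => hfree e ?_ hwe
    exact hp.mem_symmDiff_iff.2 (Or.inl ⟨he, fun hep =>
      hwp (SimpleGraph.Walk.mem_support_of_mem_edges hep hwe)⟩)
end

section
/- Let G be a finite simple graph and let M and N be matchings in G with |N| > |M|. Then the graph with edge set M ⊕ N contains at least |N| − |M| pairwise vertex-disjoint M-augmenting paths. -/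
open scoped symmDiff

variable {V : Type*}

open Finset in
/-- The degrees in a connected component sum to twice the number `k` of its edges,
and the component has at most `k + 1` vertices. -/
theorem SimpleGraph.ConnectedComponent.exists_sum_degree_eq_two_mul [Fintype V]
    (H : SimpleGraph V) [DecidableRel H.Adj] [DecidableEq H.ConnectedComponent]
    (C : H.ConnectedComponent) :
    ∃ k, ∑ v with H.connectedComponentMk v = C, H.degree v = 2 * k ∧
      #{v | H.connectedComponentMk v = C} ≤ k + 1 := by
  classical
  have hdeg (v : C.supp) : (H.induce C.supp).degree v = H.degree v :=
    degree_induce_of_neighborSet_subset fun w hw ↦ C.mem_supp_of_adj_mem_supp v.2 hw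
  refine ⟨#(H.induce C.supp).edgeFinset, ?_, ?_⟩
  · rw [← sum_degrees_eq_twice_card_edges, sum_congr rfl fun v _ ↦ hdeg v]
    exact sum_subtype _ (by simp) _
  · have h := C.connected_toSimpleGraph.card_vert_le_card_edgeSet_add_one
    rw [← Fintype.card_subtype, edgeFinset_card, ← Nat.card_eq_fintype_card,
      ← Nat.card_eq_fintype_card]
    exact h

section Matching

variable {G : SimpleGraph V} {M N : Finset (Sym2 V)}

theorem IsMatchingOn.mono (hM : IsMatchingOn G M) (h : N ⊆ M) : IsMatchingOn G N :=
  ⟨fun _ he ↦ hM.1 (h he), fun e he f hf ↦ hM.2 e (h he) f (h hf)⟩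

theorem IsMatchingOn.eq_of_mem (hM : IsMatchingOn G M) {e f : Sym2 V} {v : V}
    (he : e ∈ M) (hf : f ∈ M) (hve : v ∈ e) (hvf : v ∈ f) : e = f := by
  by_contra h
  exact hM.2 e he f hf h v hve hvf

variable [DecidableEq V]

/-- The vertices joined to `v` by an edge in `S`. -/
def partners [Fintype V] (S : Finset (Sym2 V)) (v : V) : Finset V :=
  {w | s(v, w) ∈ S}

theorem mem_partners [Fintype V] {S : Finset (Sym2 V)} {v w : V} :
    w ∈ partners S v ↔ s(v, w) ∈ S := by
  simp [partners]

theorem IsMatchingOn.card_partners_le_one [Fintype V] (hM : IsMatchingOn G M) (v : V) :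
    (partners M v).card ≤ 1 := by
  refine Finset.card_le_one.2 fun a ha b hb ↦ ?_
  rw [mem_partners] at ha hb
  exact Sym2.congr_right.1 (hM.eq_of_mem ha hb (Sym2.mem_mk_left v a) (Sym2.mem_mk_left v b))

theorem IsMatchingOn.sum_card_partners [Fintype V] (hM : IsMatchingOn G M) :
    ∑ v, (partners M v).card = 2 * M.card := by
  classical
  have hdiag : (M : Set (Sym2 V)) \ Sym2.diagSet = M :=
    sdiff_eq_left.2 (Set.disjoint_left.2 fun e he hd ↦ G.not_isDiag_of_mem_edgeSet (hM.1 he) hd)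
  have hE (_ : Fintype (SimpleGraph.fromEdgeSet (M : Set (Sym2 V))).edgeSet) :
      (SimpleGraph.fromEdgeSet (M : Set (Sym2 V))).edgeFinset = M := by
    rw [← Finset.coe_inj, SimpleGraph.coe_edgeFinset, SimpleGraph.edgeSet_fromEdgeSet, hdiag]
  have hsum := (SimpleGraph.fromEdgeSet (M : Set (Sym2 V))).sum_degrees_eq_twice_card_edges
  rw [hE] at hsum
  rw [← hsum]
  refine Finset.sum_congr rfl fun v _ ↦ congrArg Finset.card ?_
  ext w
  rw [mem_partners, SimpleGraph.mem_neighborFinset, ← SimpleGraph.mem_edgeSet,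
    SimpleGraph.edgeSet_fromEdgeSet, hdiag, Finset.mem_coe]

theorem degree_fromEdgeSet_symmDiff [Fintype V] (hM : IsMatchingOn G M) (hN : IsMatchingOn G N)
    [DecidableRel (SimpleGraph.fromEdgeSet (↑(M ∆ N) : Set (Sym2 V))).Adj] (v : V) :
    (SimpleGraph.fromEdgeSet (↑(M ∆ N) : Set (Sym2 V))).degree v =
      (partners (M \ N) v).card + (partners (N \ M) v).card := by
  rw [← Finset.card_union_of_disjoint]
  · refine congrArg Finset.card ?_
    ext w
    have hM' : s(v, w) ∈ M → v ≠ w := fun h ↦ (hM.1 h : G.Adj v w).ne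
    have hN' : s(v, w) ∈ N → v ≠ w := fun h ↦ (hN.1 h : G.Adj v w).ne
    simp only [SimpleGraph.mem_neighborFinset, SimpleGraph.fromEdgeSet_adj, Finset.mem_coe,
      Finset.mem_symmDiff, Finset.mem_union, mem_partners, Finset.mem_sdiff]
    tauto
  · refine Finset.disjoint_left.2 fun w hw hw' ↦ ?_
    rw [mem_partners, Finset.mem_sdiff] at hw hw'
    exact hw.2 hw'.1

/-- A path in the symmetric difference of two matchings that starts at an `M`-free vertex
alternates. -/
theorem isAlternatingWalk_of_isPath (hM : IsMatchingOn G M) (hN : IsMatchingOn G N) {u v : V}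
    {p : (SimpleGraph.fromEdgeSet (↑(M ∆ N) : Set (Sym2 V))).Walk u v} (hp : p.IsPath)
    (hu : IsFreeVertex M u) : IsAlternatingWalk M p := by
  intro i
  induction i with
  | zero =>
    intro h
    have : p.edges.get ⟨0, h⟩ ∉ M := fun hmem ↦ hu _ hmem (by
      simp [SimpleGraph.Walk.getElem_edges])
    simpa using this
  | succ i ih =>
    intro h
    have hi := ih (by lia)
    have hne : p.edges.get ⟨i, by lia⟩ ≠ p.edges.get ⟨i + 1, h⟩ := fun heq ↦ by
      have := (List.nodup_iff_injective_get.1 hp.isTrail.edges_nodup) heq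
      simp at this
    have hmem (j : ℕ) (hj : j < p.edges.length) : p.edges.get ⟨j, hj⟩ ∈ M ∆ N := by
      have := p.edges_subset_edgeSet (List.get_mem p.edges ⟨j, hj⟩)
      rw [SimpleGraph.edgeSet_fromEdgeSet] at this
      exact this.1
    have h₁ := hmem i (by lia)
    have h₂ := hmem (i + 1) h
    have hv₁ : p.getVert (i + 1) ∈ p.edges.get ⟨i, by lia⟩ := by
      simp [SimpleGraph.Walk.getElem_edges]
    have hv₂ : p.getVert (i + 1) ∈ p.edges.get ⟨i + 1, h⟩ := by
      simp [SimpleGraph.Walk.getElem_edges]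
    rw [Finset.mem_symmDiff] at h₁ h₂
    have hM' := fun a b ↦ hne (hM.eq_of_mem a b hv₁ hv₂)
    have hN' := fun a b ↦ hne (hN.eq_of_mem a b hv₁ hv₂)
    have hpar : (i + 1) % 2 = 1 ↔ ¬ i % 2 = 1 := by lia
    rw [hpar, ← hi]
    tauto

open Finset in
/-- A component of the symmetric difference covering more vertices by `N` than by `M` does so
by at most two, and contains an `M`-augmenting path. -/
theorem exists_isAugmentingPath_of_component [Fintype V]
    (hM : IsMatchingOn G M) (hN : IsMatchingOn G N)
    [DecidableEq (SimpleGraph.fromEdgeSet (↑(M ∆ N) : Set (Sym2 V))).ConnectedComponent]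
    (C : (SimpleGraph.fromEdgeSet (↑(M ∆ N) : Set (Sym2 V))).ConnectedComponent)
    (hC : ∑ v with SimpleGraph.connectedComponentMk _ v = C, #(partners (M \ N) v) <
      ∑ v with SimpleGraph.connectedComponentMk _ v = C, #(partners (N \ M) v)) :
    ∑ v with SimpleGraph.connectedComponentMk _ v = C, #(partners (N \ M) v) =
        ∑ v with SimpleGraph.connectedComponentMk _ v = C, #(partners (M \ N) v) + 2 ∧
      ∃ (u v : V) (p : (SimpleGraph.fromEdgeSet (↑(M ∆ N) : Set (Sym2 V))).Walk u v),
        IsAugmentingPath _ M p ∧ SimpleGraph.connectedComponentMk _ u = C := by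
  classical
  obtain ⟨k, hk, hcard⟩ := C.exists_sum_degree_eq_two_mul
  simp_rw [degree_fromEdgeSet_symmDiff hM hN, sum_add_distrib] at hk
  have hM₁ := (hM.mono (sdiff_subset (t := N))).card_partners_le_one
  have hN₁ := (hN.mono (sdiff_subset (t := M))).card_partners_le_one
  set S : Finset V := {v | SimpleGraph.connectedComponentMk _ v = C} with hS
  have hNle : ∑ v ∈ S, #(partners (N \ M) v) ≤ #S := by
    simpa using sum_le_card_nsmul S _ 1 fun v _ ↦ hN₁ v
  have hMN : ∑ v ∈ S, #(partners (N \ M) v) = ∑ v ∈ S, #(partners (M \ N) v) + 2 := by lia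
  have hNS : ∑ v ∈ S, #(partners (N \ M) v) = ∑ v ∈ S, 1 := by simp; lia
  have hN₂ := (sum_eq_sum_iff_of_le fun v _ ↦ hN₁ v).1 hNS
  have hfree {v : V} (hv : v ∈ S) (h0 : #(partners (M \ N) v) = 0) : IsFreeVertex M v := by
    intro e he hve
    obtain ⟨w, rfl⟩ := hve
    obtain ⟨x, hx⟩ := card_pos.1 ((hN₂ v hv).symm ▸ Nat.one_pos)
    rw [mem_partners, mem_sdiff] at hx
    by_cases heN : s(v, w) ∈ N
    · exact hx.2 (hN.eq_of_mem heN hx.1 (Sym2.mem_mk_left v w) (Sym2.mem_mk_left v x) ▸ he)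
    · have : w ∈ partners (M \ N) v := mem_partners.2 (mem_sdiff.2 ⟨he, heN⟩)
      simp_all
  have hsplit : #{v ∈ S | #(partners (M \ N) v) = 0} + ∑ v ∈ S, #(partners (M \ N) v) = #S := by
    rw [card_filter, ← sum_add_distrib, card_eq_sum_ones]
    refine sum_congr rfl fun v _ ↦ ?_
    have := hM₁ v
    split_ifs <;> lia
  have htwo : 1 < #{v ∈ S | #(partners (M \ N) v) = 0} := by simp at hNS; lia
  obtain ⟨u, hu, v, hv, huv⟩ := one_lt_card.1 htwo
  rw [mem_filter] at hu hv
  have huC := (mem_filter.1 hu.1).2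
  have hvC := (mem_filter.1 hv.1).2
  obtain ⟨p, hp⟩ := (SimpleGraph.ConnectedComponent.exact (huC.trans hvC.symm)).exists_isPath
  have huf := hfree hu.1 hu.2
  exact ⟨hMN, u, v, p,
    ⟨hp, huv, huf, hfree hv.1 hv.2, isAlternatingWalk_of_isPath hM hN hp huf⟩, huC⟩

end Matching

/-- If `M` and `N` are matchings in a finite simple graph `G` with
`|N| > |M|`, then the graph with edge set `M ∆ N` contains at least `|N| - |M|`
pairwise vertex-disjoint `M`-augmenting paths. -/
theorem symmDiff_contains_disjoint_augmenting_paths [Fintype V] [DecidableEq V]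
    (G : SimpleGraph V) (M N : Finset (Sym2 V))
    (hM : IsMatchingOn G M) (hN : IsMatchingOn G N) (hcard : M.card < N.card) :
    ∃ (s t : Fin (N.card - M.card) → V)
      (p : ∀ i, (SimpleGraph.fromEdgeSet (↑(M ∆ N) : Set (Sym2 V))).Walk (s i) (t i)),
      (∀ i, IsAugmentingPath (SimpleGraph.fromEdgeSet (↑(M ∆ N) : Set (Sym2 V))) M (p i)) ∧
      ∀ i j, i ≠ j → ∀ w : V, w ∈ (p i).support → w ∉ (p j).support := by
  classical
  let H := SimpleGraph.fromEdgeSet (↑(M ∆ N) : Set (Sym2 V))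
  let m (C : H.ConnectedComponent) :=
    ∑ v with H.connectedComponentMk v = C, (partners (M \ N) v).card
  let n (C : H.ConnectedComponent) :=
    ∑ v with H.connectedComponentMk v = C, (partners (N \ M) v).card
  have hm : ∑ C, m C = 2 * (M \ N).card :=
    (Finset.sum_fiberwise _ _ _).trans (hM.mono Finset.sdiff_subset).sum_card_partners
  have hn : ∑ C, n C = 2 * (N \ M).card :=
    (Finset.sum_fiberwise _ _ _).trans (hN.mono Finset.sdiff_subset).sum_card_partners
  let good : Finset H.ConnectedComponent := {C | m C < n C}
  have hle : ∑ C, n C ≤ ∑ C, m C + 2 * good.card := by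
    rw [Finset.card_filter, Finset.mul_sum, ← Finset.sum_add_distrib]
    refine Finset.sum_le_sum fun C _ ↦ ?_
    split_ifs with h
    · exact (exists_isAugmentingPath_of_component hM hN C h).1.le
    · lia
  have hsdiff := Finset.card_sdiff_add_card_inter M N
  have hsdiff' := Finset.card_sdiff_add_card_inter N M
  rw [Finset.inter_comm] at hsdiff'
  have hgood : N.card - M.card ≤ good.card := by lia
  let c (i : Fin (N.card - M.card)) : good := good.equivFin.symm (Fin.castLE hgood i)
  have hc : Function.Injective c :=
    good.equivFin.symm.injective.comp (Fin.castLE_injective hgood)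
  have key (i) := (exists_isAugmentingPath_of_component hM hN (c i).1
    (Finset.mem_filter.1 (c i).2).2).2
  choose s t p hp hs using key
  refine ⟨s, t, p, hp, fun i j hij w hi hj ↦ hij (hc (Subtype.ext ?_))⟩
  rw [← hs i, ← hs j]
  exact SimpleGraph.ConnectedComponent.sound
    (((p i).takeUntil w hi).reachable.trans ((p j).takeUntil w hj).reachable.symm)
end

section
/- Let G be a finite simple graph, M a matching in G, and M* a maximum matching of G, and suppose s := |M*| − |M| ≥ 1. Then G contains an M-augmenting path that uses at most ⌊|M|/s⌋ edges of M, and hence has length at most 2⌊|M|/s⌋ + 1. -/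
variable {V : Type*}

section AlternatingOrbit

/-- The alternating orbit `u, n u, m (n u), n (m (n u)), …` of `u` under two maps `m` and `n`. -/
def alternatingOrbit (m n : V → V) (u : V) : ℕ → V
  | 0 => u
  | t + 1 => if t % 2 = 0 then n (alternatingOrbit m n u t) else m (alternatingOrbit m n u t)

theorem alternatingOrbit_succ_of_even (m n : V → V) (u : V) {t : ℕ} (ht : t % 2 = 0) :
    alternatingOrbit m n u (t + 1) = n (alternatingOrbit m n u t) := by
  simp [alternatingOrbit, ht]

theorem alternatingOrbit_succ_of_odd (m n : V → V) (u : V) {t : ℕ} (ht : t % 2 = 1) :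
    alternatingOrbit m n u (t + 1) = m (alternatingOrbit m n u t) := by
  simp [alternatingOrbit, ht]

/-- Two orbits starting at fixed points of `m` that meet at times of equal parity, the later one
not yet having stalled, are the same orbit at the same time. -/
theorem alternatingOrbit_eq_of_mod_eq {m n : V → V} (hm : m.Involutive) (hn : n.Involutive)
    {u w : V} (hu : m u = u) {p q : ℕ} (hpq : p ≤ q) (hpar : p % 2 = q % 2)
    (heq : alternatingOrbit m n u p = alternatingOrbit m n w q)
    (hmove : ∀ t < q, alternatingOrbit m n w (t + 1) ≠ alternatingOrbit m n w t) :
    u = w ∧ p = q := by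
  induction p generalizing q with
  | zero =>
    obtain _ | q := q
    · exact ⟨heq, rfl⟩
    · have hstep := alternatingOrbit_succ_of_odd m n w (t := q) (by omega)
      refine absurd ?_ (hmove q (by omega))
      have h : m (alternatingOrbit m n w (q + 1)) = alternatingOrbit m n w q := by
        rw [hstep, hm]
      rw [← h, ← heq]
      exact hu.symm
  | succ p ih =>
    obtain _ | q := q
    · omega
    · have hprev : alternatingOrbit m n u p = alternatingOrbit m n w q := by
        rcases Nat.mod_two_eq_zero_or_one p with hp | hp
        · rw [alternatingOrbit_succ_of_even m n u hp,
            alternatingOrbit_succ_of_even m n w (by omega)] at heq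
          exact hn.injective heq
        · rw [alternatingOrbit_succ_of_odd m n u hp,
            alternatingOrbit_succ_of_odd m n w (by omega)] at heq
          exact hm.injective heq
      have h := ih (by omega) (by omega) hprev fun t ht => hmove t (by omega)
      exact ⟨h.1, by rw [h.2]⟩

/-- An orbit that has not stalled does not meet itself at times of different parity. -/
theorem alternatingOrbit_ne_of_mod_ne {m n : V → V} (hm : m.Involutive) (hn : n.Involutive)
    {u : V} (d p : ℕ)
    (hmove : ∀ t < p + 2 * d + 1, alternatingOrbit m n u (t + 1) ≠ alternatingOrbit m n u t) :
    alternatingOrbit m n u p ≠ alternatingOrbit m n u (p + 2 * d + 1) := by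
  induction d generalizing p with
  | zero => exact (hmove p (by omega)).symm
  | succ d ih =>
    intro heq
    refine ih (p + 1) (fun t ht => hmove t (by omega)) ?_
    have hlast : p + 2 * (d + 1) + 1 = (p + 1 + 2 * d + 1) + 1 := by omega
    rw [hlast] at heq
    rcases Nat.mod_two_eq_zero_or_one p with hp | hp
    · rw [alternatingOrbit_succ_of_even m n u hp, heq,
        alternatingOrbit_succ_of_even m n u (t := p + 1 + 2 * d + 1) (by omega), hn]
    · rw [alternatingOrbit_succ_of_odd m n u hp, heq,
        alternatingOrbit_succ_of_odd m n u (t := p + 1 + 2 * d + 1) (by omega), hm]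

/-- The orbit of a fixed point of `m` is injective up to the time at which it stalls. -/
theorem alternatingOrbit_injOn {m n : V → V} (hm : m.Involutive) (hn : n.Involutive)
    {u : V} (hu : m u = u) {l : ℕ}
    (hmove : ∀ t < l, alternatingOrbit m n u (t + 1) ≠ alternatingOrbit m n u t) :
    Set.InjOn (alternatingOrbit m n u) {t | t ≤ l} := by
  have key : ∀ p q, p ≤ q → q ≤ l → alternatingOrbit m n u p = alternatingOrbit m n u q →
      p = q := by
    intro p q hpq hql heq
    by_cases hpar : p % 2 = q % 2
    · exact (alternatingOrbit_eq_of_mod_eq hm hn hu hpq hpar heq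
        fun t ht => hmove t (by omega)).2
    · obtain ⟨d, rfl⟩ : ∃ d, q = p + 2 * d + 1 := ⟨(q - p) / 2, by omega⟩
      exact absurd heq (alternatingOrbit_ne_of_mod_ne hm hn d p fun t ht => hmove t (by omega))
  intro p hp q hq heq
  rcases le_total p q with h | h
  · exact key p q h hq heq
  · exact (key q p h hp heq.symm).symm

/-- If the involution `m` has at least `r` more fixed points than the involution `n`, and fewer
than `r * (k + 1)` non-fixed points, then some orbit of a fixed point of `m` first stalls at
another fixed point of `m`, after at most `2 * k + 1` steps. -/
theorem exists_alternatingOrbit_stall [Fintype V] [DecidableEq V] {m n : V → V}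
    (hm : m.Involutive) (hn : n.Involutive) {r k : ℕ}
    (hfix : (Finset.univ.filter fun v => n v = v).card + r
      ≤ (Finset.univ.filter fun v => m v = v).card)
    (hmoved : (Finset.univ.filter fun v => m v ≠ v).card < r * (k + 1)) :
    ∃ u, m u = u ∧ ∃ j ≤ k,
      (∀ t < 2 * j + 1, alternatingOrbit m n u (t + 1) ≠ alternatingOrbit m n u t) ∧
      m (alternatingOrbit m n u (2 * j + 1)) = alternatingOrbit m n u (2 * j + 1) := by
  by_contra! hcon
  set survives : V → Prop := fun u =>
    ∀ t < 2 * k + 1, alternatingOrbit m n u (t + 1) ≠ alternatingOrbit m n u t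
  classical
  have hstalled : ((Finset.univ.filter fun v => m v = v).filter fun u => ¬ survives u).card
      ≤ (Finset.univ.filter fun v => n v = v).card := by
    have hex : ∀ u, ∃ i, m u = u → ¬ survives u → i % 2 = 0 ∧
        alternatingOrbit m n u (i + 1) = alternatingOrbit m n u i ∧
        ∀ t < i, alternatingOrbit m n u (t + 1) ≠ alternatingOrbit m n u t := by
      intro u
      by_cases h : m u = u ∧ ¬ survives u
      · obtain ⟨hu, hns⟩ := h
        simp only [survives] at hns
        push Not at hns
        obtain ⟨t, htk, ht⟩ := hns
        have hstall : ∃ t, alternatingOrbit m n u (t + 1) = alternatingOrbit m n u t := ⟨t, ht⟩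
        have hle := Nat.find_min' hstall ht
        have hspec := Nat.find_spec hstall
        have hmin : ∀ t < Nat.find hstall,
          alternatingOrbit m n u (t + 1) ≠ alternatingOrbit m n u t :=
          fun t ht => Nat.find_min hstall ht
        generalize Nat.find hstall = i at hle hspec hmin
        refine ⟨i, fun _ _ => ⟨?_, hspec, hmin⟩⟩
        by_contra hodd
        obtain ⟨j, rfl⟩ : ∃ j, i = 2 * j + 1 := ⟨i / 2, by omega⟩
        refine hcon u hu j (by omega) hmin ?_
        rwa [alternatingOrbit_succ_of_odd m n u (by omega)] at hspec
      · exact ⟨0, fun h₁ h₂ => absurd ⟨h₁, h₂⟩ h⟩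
    choose i hi using hex
    refine Finset.card_le_card_of_injOn (fun u => alternatingOrbit m n u (i u)) ?_ ?_
    · intro u hu
      simp only [Finset.coe_filter, Finset.mem_filter, Finset.mem_univ, true_and,
        Set.mem_ofPred_eq] at hu ⊢
      obtain ⟨hpar, hspec, -⟩ := hi u hu.1 hu.2
      rwa [alternatingOrbit_succ_of_even m n u hpar] at hspec
    · intro u hu w hw heq
      simp only [Finset.coe_filter, Finset.mem_filter, Finset.mem_univ, true_and,
        Set.mem_ofPred_eq] at hu hw
      obtain ⟨hpu, -, hmu⟩ := hi u hu.1 hu.2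
      obtain ⟨hpw, -, hmw⟩ := hi w hw.1 hw.2
      rcases le_total (i u) (i w) with h | h
      · exact (alternatingOrbit_eq_of_mod_eq hm hn hu.1 h (by omega) heq hmw).1
      · exact (alternatingOrbit_eq_of_mod_eq hm hn hw.1 h (by omega) heq.symm hmu).1.symm
  have hsurv : ((Finset.univ.filter fun v => m v = v).filter survives).card * (k + 1)
      ≤ (Finset.univ.filter fun v => m v ≠ v).card := by
    rw [← Finset.card_range (k + 1), ← Finset.card_product]
    refine Finset.card_le_card_of_injOn
      (fun x : V × ℕ => alternatingOrbit m n x.1 (2 * x.2 + 1)) ?_ ?_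
    · rintro ⟨u, j⟩ hx
      simp only [Finset.coe_product, Set.mem_prod, Finset.mem_coe, Finset.mem_filter,
        Finset.mem_univ, true_and, Finset.mem_range] at hx ⊢
      exact hcon u hx.1.1 j (by omega) fun t ht => hx.1.2 t (by omega)
    · rintro ⟨u, j⟩ hx ⟨w, l⟩ hy heq
      simp only [Finset.coe_product, Set.mem_prod, Finset.mem_coe, Finset.mem_filter,
        Finset.mem_univ, true_and, Finset.mem_range] at hx hy heq
      rcases le_total j l with h | h
      · obtain ⟨h₁, h₂⟩ := alternatingOrbit_eq_of_mod_eq hm hn hx.1.1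
          (by omega : 2 * j + 1 ≤ 2 * l + 1) (by omega) heq fun t ht => hy.1.2 t (by omega)
        exact Prod.ext h₁ (by simp only; omega)
      · obtain ⟨h₁, h₂⟩ := alternatingOrbit_eq_of_mod_eq hm hn hy.1.1
          (by omega : 2 * l + 1 ≤ 2 * j + 1) (by omega) heq.symm fun t ht => hx.1.2 t (by omega)
        exact Prod.ext h₁.symm (by simp only; omega)
  have hsplit := Finset.card_filter_add_card_filter_not
    (s := Finset.univ.filter fun v => m v = v) survives
  have hr : r ≤ ((Finset.univ.filter fun v => m v = v).filter survives).card := by omega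
  have := Nat.mul_le_mul_right (k + 1) hr
  omega

end AlternatingOrbit

section Mate

open Classical in
/-- The partner of `v` in the matching `M`, or `v` itself if `v` is free. -/
noncomputable def mate (M : Finset (Sym2 V)) (v : V) : V :=
  if h : ∃ w, s(v, w) ∈ M then h.choose else v

namespace IsMatchingOn

variable {G : SimpleGraph V} {M : Finset (Sym2 V)}

theorem mate_eq (hM : IsMatchingOn G M) {v w : V} (h : s(v, w) ∈ M) : mate M v = w := by
  have hex : ∃ w, s(v, w) ∈ M := ⟨w, h⟩
  rw [mate, dif_pos hex]
  have hc := hex.choose_spec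
  by_contra hne
  refine hM.2 _ hc _ h (fun heq => hne ?_) v (by simp) (by simp)
  exact Sym2.congr_right.1 heq

theorem mate_ne (hM : IsMatchingOn G M) {v w : V} (h : s(v, w) ∈ M) : mate M v ≠ v := by
  rw [hM.mate_eq h]
  exact (G.ne_of_adj (hM.1 h)).symm

end IsMatchingOn

theorem mk_mate_mem {M : Finset (Sym2 V)} {v : V} (h : mate M v ≠ v) : s(v, mate M v) ∈ M := by
  by_cases hex : ∃ w, s(v, w) ∈ M
  · rw [mate, dif_pos hex]
    exact hex.choose_spec
  · exact absurd (by rw [mate, dif_neg hex]) h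

namespace IsMatchingOn

variable {G : SimpleGraph V} {M : Finset (Sym2 V)}

theorem mate_involutive (hM : IsMatchingOn G M) : (mate M).Involutive := by
  intro v
  by_cases h : mate M v = v
  · rw [h, h]
  · exact hM.mate_eq (by rw [Sym2.eq_swap]; exact mk_mate_mem h)

theorem isFreeVertex_of_mate_eq (hM : IsMatchingOn G M) {v : V} (h : mate M v = v) :
    IsFreeVertex M v := by
  intro e he hv
  obtain ⟨w, rfl⟩ := hv
  exact hM.mate_ne he h

theorem card_mate_ne [Fintype V] [DecidableEq V] (hM : IsMatchingOn G M) :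
    (Finset.univ.filter fun v => mate M v ≠ v).card = 2 * M.card := by
  have hunion : (Finset.univ.filter fun v => mate M v ≠ v) = M.biUnion Sym2.toFinset := by
    ext v
    simp only [Finset.mem_filter, Finset.mem_univ, true_and, Finset.mem_biUnion, Sym2.mem_toFinset]
    refine ⟨fun h => ⟨_, mk_mate_mem h, by simp⟩, ?_⟩
    rintro ⟨e, he, w, rfl⟩
    exact hM.mate_ne he
  rw [hunion, Finset.card_biUnion, Finset.sum_const_nat (m := 2), mul_comm]
  · exact fun e he => Sym2.card_toFinset_of_not_isDiag e (G.not_isDiag_of_mem_edgeSet (hM.1 he))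
  · intro e he f hf hne
    rw [Function.onFun, Finset.disjoint_left]
    intro v hv hv'
    exact hM.2 e he f hf hne v (by simpa using hv) (by simpa using hv')

end IsMatchingOn

end Mate

/-- A sequence of successively adjacent vertices is traversed by a walk. -/
theorem exists_walk_of_adj {G : SimpleGraph V} (c : ℕ → V) (l : ℕ)
    (hadj : ∀ t < l, G.Adj (c t) (c (t + 1))) :
    ∃ p : G.Walk (c 0) (c l), p.support = (List.range (l + 1)).map c ∧
      p.edges = (List.range l).map fun t => s(c t, c (t + 1)) := by
  induction l with
  | zero => exact ⟨.nil, by simp, by simp⟩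
  | succ l ih =>
    obtain ⟨p, hs, he⟩ := ih fun t ht => hadj t (by omega)
    refine ⟨p.concat (hadj l (by omega)), ?_, ?_⟩
    · rw [SimpleGraph.Walk.support_concat, hs, List.range_succ (n := l + 1)]
      simp
    · rw [SimpleGraph.Walk.edges_concat, he, List.range_succ (n := l)]
      simp

/-- If the orbit of an `M`-free vertex under the partner maps first stalls at an `M`-free vertex,
then it traverses an augmenting path. -/
theorem exists_isAugmentingPath_of_alternatingOrbit [DecidableEq V] {G : SimpleGraph V}
    {M N : Finset (Sym2 V)} (hM : IsMatchingOn G M) (hN : IsMatchingOn G N) {u : V} {j : ℕ}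
    (hu : mate M u = u)
    (hmove : ∀ t < 2 * j + 1, alternatingOrbit (mate M) (mate N) u (t + 1)
      ≠ alternatingOrbit (mate M) (mate N) u t)
    (hend : mate M (alternatingOrbit (mate M) (mate N) u (2 * j + 1))
      = alternatingOrbit (mate M) (mate N) u (2 * j + 1)) :
    ∃ (v w : V) (p : G.Walk v w), IsAugmentingPath G M p ∧
      (p.edges.toFinset ∩ M).card ≤ j ∧ p.length = 2 * j + 1 := by
  have hinj := alternatingOrbit_injOn hM.mate_involutive hN.mate_involutive hu hmove
  have heven := fun t => alternatingOrbit_succ_of_even (mate M) (mate N) u (t := t)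
  have hodd := fun t => alternatingOrbit_succ_of_odd (mate M) (mate N) u (t := t)
  have hzero : alternatingOrbit (mate M) (mate N) u 0 = u := rfl
  generalize alternatingOrbit (mate M) (mate N) u = c at *
  have hmemN : ∀ t < 2 * j + 1, t % 2 = 0 → s(c t, c (t + 1)) ∈ N := by
    intro t ht hpar
    have h := hmove t ht
    rw [heven t hpar] at h ⊢
    exact mk_mate_mem h
  have hmemM : ∀ t < 2 * j + 1, (s(c t, c (t + 1)) ∈ M ↔ t % 2 = 1) := by
    intro t ht
    constructor
    · intro hmem
      by_contra hpar
      obtain _ | t := t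
      · exact hM.mate_ne hmem (by rw [hzero, hu])
      · have h := hM.mate_eq hmem
        rw [hodd t (by omega), hM.mate_involutive] at h
        have := hinj (by simp only [Set.mem_ofPred_eq]; omega)
          (by simp only [Set.mem_ofPred_eq]; omega) h
        omega
    · intro hpar
      have h := hmove t ht
      rw [hodd t hpar] at h ⊢
      exact mk_mate_mem h
  have hadj : ∀ t < 2 * j + 1, G.Adj (c t) (c (t + 1)) := by
    intro t ht
    rcases Nat.mod_two_eq_zero_or_one t with hpar | hpar
    · exact hN.1 (hmemN t ht hpar)
    · exact hM.1 ((hmemM t ht).2 hpar)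
  obtain ⟨p, hs, he⟩ := exists_walk_of_adj c (2 * j + 1) hadj
  refine ⟨_, _, p, ⟨?_, ?_, ?_, hM.isFreeVertex_of_mate_eq hend, ?_⟩, ?_, ?_⟩
  · rw [SimpleGraph.Walk.isPath_def, hs]
    refine List.Nodup.map_on (fun a ha b hb h => ?_) List.nodup_range
    simp only [List.mem_range] at ha hb
    exact hinj (by simp only [Set.mem_ofPred_eq]; omega) (by simp only [Set.mem_ofPred_eq]; omega) h
  · intro h
    have := hinj (by simp) (by simp) h
    omega
  · exact hM.isFreeVertex_of_mate_eq (by rw [hzero, hu])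
  · intro i hi
    have hlen : i < 2 * j + 1 := by simpa [he] using hi
    simpa [he] using hmemM i hlen
  · have hsub : p.edges.toFinset ∩ M
        ⊆ (Finset.range j).image fun i => s(c (2 * i + 1), c (2 * i + 1 + 1)) := by
      intro e hmem
      rw [Finset.mem_inter, List.mem_toFinset, he, List.mem_map] at hmem
      obtain ⟨⟨t, ht, rfl⟩, htM⟩ := hmem
      rw [List.mem_range] at ht
      have hpar := (hmemM t ht).1 htM
      obtain ⟨i, rfl⟩ : ∃ i, t = 2 * i + 1 := ⟨t / 2, by omega⟩
      exact Finset.mem_image.2 ⟨i, Finset.mem_range.2 (by omega), rfl⟩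
    simpa using (Finset.card_le_card hsub).trans Finset.card_image_le
  · rw [← SimpleGraph.Walk.length_edges, he]
    simp

/-- If `M` is a matching in the finite simple graph `G`, `M*` is a
maximum matching, and `s = |M*| - |M| ≥ 1`, then `G` contains an `M`-augmenting path
using at most `⌊|M|/s⌋` edges of `M`, hence of length at most `2⌊|M|/s⌋ + 1`. -/
theorem exists_short_augmenting_path [Fintype V] [DecidableEq V]
    (G : SimpleGraph V) (M Mstar : Finset (Sym2 V))
    (hM : IsMatchingOn G M) (hMstar : IsMatchingOn G Mstar)
    (hmax : ∀ N : Finset (Sym2 V), IsMatchingOn G N → N.card ≤ Mstar.card)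
    (s : ℕ) (hs : s = Mstar.card - M.card) (hs1 : 1 ≤ s) :
    ∃ (u v : V) (p : G.Walk u v), IsAugmentingPath G M p ∧
      (p.edges.toFinset ∩ M).card ≤ M.card / s ∧
      p.length ≤ 2 * (M.card / s) + 1 := by
  have hcardM := hM.card_mate_ne
  have hcardN := hMstar.card_mate_ne
  have hsumM := Finset.card_filter_add_card_filter_not
    (s := (Finset.univ : Finset V)) fun v => mate M v = v
  have hsumN := Finset.card_filter_add_card_filter_not
    (s := (Finset.univ : Finset V)) fun v => mate Mstar v = v
  have hlt : M.card < s * (M.card / s + 1) := Nat.lt_mul_div_succ _ hs1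
  obtain ⟨u, hu, j, hj, hmove, hend⟩ :=
    exists_alternatingOrbit_stall hM.mate_involutive hMstar.mate_involutive
      (r := 2 * s) (k := M.card / s)
      (by simp only [ne_eq] at hcardM hcardN; omega) (by rw [hcardM, mul_assoc]; omega)
  obtain ⟨v, w, p, hp, hpM, hpl⟩ :=
    exists_isAugmentingPath_of_alternatingOrbit hM hMstar hu hmove hend
  exact ⟨v, w, p, hp, hpM.trans hj, by omega⟩
end
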